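/- For every ξ > 0, every nonzero x in R^3 with r = |x| and r̂ = x/|x|, and all indices j, l in {1,2,3}: (δ_{jl} Δ − ∂_j ∂_l) [ |x| − Φ_H(|x|, ξ) ] = 2 ( ξ e^{-ξ^2 r^2}/√π + erfc(ξ r)/(2r) ) ( δ_{jl} + r̂_j r̂_l ) − (4ξ/√π) e^{-ξ^2 r^2} δ_{jl}, where Φ_H(r, ξ) = r erf(ξ r) + e^{-ξ^2 r^2}/(√π ξ), Δ is the Laplacian on R^3, and δ_{jl} is the Kronecker delta. -/

import Mathlib

open MeasureTheory Real Filter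

noncomputable section

/-- Euclidean 3-space. -/
abbrev E3 := EuclideanSpace ℝ (Fin 3)

/-- Partial derivative in the `j`-th coordinate direction. -/
def pd (j : Fin 3) (f : E3 → ℝ) (x : E3) : ℝ :=
  fderiv ℝ f x (EuclideanSpace.single j 1)

/-- Laplacian on `E3`. -/
def lap (f : E3 → ℝ) (x : E3) : ℝ :=
  ∑ i : Fin 3, pd i (pd i f) x

/-- Gauss error function. -/
def erf (t : ℝ) : ℝ := (2 / Real.sqrt π) * ∫ s in (0:ℝ)..t, Real.exp (-s ^ 2)

/-- Complementary error function. -/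
def erfc (t : ℝ) : ℝ := 1 - erf t

/-- Kronecker delta on `Fin 3`. -/
def kron (j l : Fin 3) : ℝ := if j = l then 1 else 0

/-- Levi-Civita symbol on `Fin 3`. -/
def lev (j l m : Fin 3) : ℝ :=
  ((l.val : ℝ) - (j.val : ℝ)) * ((m.val : ℝ) - (l.val : ℝ)) * ((m.val : ℝ) - (j.val : ℝ)) / 2

open Topology

lemma single_inner_eq (x : E3) (j : Fin 3) :
    inner ℝ x (EuclideanSpace.single j (1 : ℝ)) = x j := by
  simp [EuclideanSpace.inner_single_right]

lemma hasFDerivAt_norm_of_ne_zero {x : E3} (hx : x ≠ 0) :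
    HasFDerivAt (fun y : E3 => ‖y‖) (‖x‖⁻¹ • innerSL ℝ x) x := by
  have hn : ‖x‖ ≠ 0 := norm_ne_zero_iff.mpr hx
  have h := (hasStrictFDerivAt_norm_sq x).hasFDerivAt.sqrt (pow_ne_zero 2 hn)
  simp only [Real.sqrt_sq (norm_nonneg _)] at h
  refine h.congr_fderiv ?_
  ext v
  simp
  field_simp

/-- Partial derivatives of a radial function. -/
lemma pd_radial {F : ℝ → ℝ} {F' : ℝ} {x : E3} (hx : x ≠ 0) (hF : HasDerivAt F F' ‖x‖)
    (j : Fin 3) : pd j (fun y => F ‖y‖) x = F' / ‖x‖ * x j := by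
  have h := hF.comp_hasFDerivAt x (hasFDerivAt_norm_of_ne_zero hx)
  simp only [pd]
  rw [show (fun y : E3 => F ‖y‖) = F ∘ fun y => ‖y‖ from rfl, h.fderiv]
  simp [single_inner_eq]
  ring

/-- Second partial derivatives of a radial function. -/
lemma pd_pd_radial {F F' : ℝ → ℝ} {F'' : ℝ} {x : E3} (hx : x ≠ 0)
    (hF : ∀ r, HasDerivAt F (F' r) r) (hF' : HasDerivAt F' F'' ‖x‖) (j l : Fin 3) :
    pd j (pd l (fun y => F ‖y‖)) x
      = F'' * ((x j / ‖x‖) * (x l / ‖x‖))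
        + F' ‖x‖ / ‖x‖ * (kron j l - (x j / ‖x‖) * (x l / ‖x‖)) := by
  have hn : ‖x‖ ≠ 0 := norm_ne_zero_iff.mpr hx
  have hev : pd l (fun y => F ‖y‖) =ᶠ[𝓝 x] fun y => F' ‖y‖ / ‖y‖ * y l := by
    filter_upwards [isOpen_ne.mem_nhds hx] with y hy
    exact pd_radial hy (hF _) l
  have hG := (hF'.div (hasDerivAt_id ‖x‖) hn).comp_hasFDerivAt x (hasFDerivAt_norm_of_ne_zero hx)
  have hl : HasFDerivAt (fun y : E3 => y l) (EuclideanSpace.proj l : E3 →L[ℝ] ℝ) x :=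
    (EuclideanSpace.proj l : E3 →L[ℝ] ℝ).hasFDerivAt
  have h : HasFDerivAt (fun y : E3 => F' ‖y‖ / ‖y‖ * y l) _ x := hG.mul hl
  have hk : (EuclideanSpace.single j (1 : ℝ) : E3) l = kron j l := by
    simp [kron, eq_comm]
  simp only [pd] at hev ⊢
  rw [hev.fderiv_eq, h.fderiv]
  simp [single_inner_eq, -PiLp.single_apply, hk]
  field_simp
  ring

lemma hasDerivAt_erf (t : ℝ) : HasDerivAt erf (2 / √π * exp (-t ^ 2)) t := by
  have hc : Continuous fun s : ℝ => exp (-s ^ 2) := by fun_prop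
  exact (hc.integral_hasStrictDerivAt 0 t).hasDerivAt.const_mul _

lemma hasDerivAt_erfc_mul (ξ r : ℝ) :
    HasDerivAt (fun r => erfc (ξ * r)) (-(2 * ξ / √π * exp (-ξ ^ 2 * r ^ 2))) r := by
  have h := ((hasDerivAt_erf (ξ * r)).comp r ((hasDerivAt_id r).const_mul ξ)).const_sub 1
  refine h.congr_deriv ?_
  rw [show -(ξ * r) ^ 2 = -ξ ^ 2 * r ^ 2 by ring]
  ring

/-- The radial profile `r - Φ_H(r, ξ)` is a primitive of `erfc (ξ r)`. -/
lemma hasDerivAt_hasimoto (ξ r : ℝ) :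
    HasDerivAt (fun r => r - (r * erf (ξ * r) + exp (-ξ ^ 2 * r ^ 2) / (√π * ξ)))
      (erfc (ξ * r)) r := by
  have herf := (hasDerivAt_erf (ξ * r)).comp r ((hasDerivAt_id r).const_mul ξ)
  have hexp := (((hasDerivAt_pow 2 r).const_mul (-ξ ^ 2)).exp).div_const (√π * ξ)
  have h := (hasDerivAt_id r).sub (((hasDerivAt_id r).mul herf).add hexp)
  refine h.congr_deriv ?_
  rw [show -(ξ * r) ^ 2 = -ξ ^ 2 * r ^ 2 by ring]
  simp [erfc]
  field_simp
  ring

/-- Real-space part of the Hasimoto Ewald decomposition of the stokeslet: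
`(δ_{jl}Δ − ∂_j∂_l)[|x| − Φ_H(|x|, ξ)] = S^R_{jl}(x, ξ)`. -/
theorem stokeslet_real_space_hasimoto (ξ : ℝ) (hξ : 0 < ξ) (x : E3) (hx : x ≠ 0)
    (j l : Fin 3) :
    kron j l * lap (fun y => ‖y‖ - (‖y‖ * erf (ξ * ‖y‖)
          + Real.exp (-ξ ^ 2 * ‖y‖ ^ 2) / (Real.sqrt π * ξ))) x
      - pd j (pd l (fun y => ‖y‖ - (‖y‖ * erf (ξ * ‖y‖)
          + Real.exp (-ξ ^ 2 * ‖y‖ ^ 2) / (Real.sqrt π * ξ)))) x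
    = 2 * (ξ * Real.exp (-ξ ^ 2 * ‖x‖ ^ 2) / Real.sqrt π
          + erfc (ξ * ‖x‖) / (2 * ‖x‖))
        * (kron j l + (x j / ‖x‖) * (x l / ‖x‖))
      - (4 * ξ / Real.sqrt π) * Real.exp (-ξ ^ 2 * ‖x‖ ^ 2) * kron j l := by
  have hn : ‖x‖ ≠ 0 := norm_ne_zero_iff.mpr hx
  have hpd := pd_pd_radial hx (hasDerivAt_hasimoto ξ) (hasDerivAt_erfc_mul ξ ‖x‖)
  have hsum : (x 0 / ‖x‖) * (x 0 / ‖x‖) + (x 1 / ‖x‖) * (x 1 / ‖x‖)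
      + (x 2 / ‖x‖) * (x 2 / ‖x‖) = 1 := by
    have h := EuclideanSpace.real_norm_sq_eq x
    rw [Fin.sum_univ_three] at h
    field_simp
    exact h.symm
  have hlap : lap (fun y => ‖y‖ - (‖y‖ * erf (ξ * ‖y‖)
      + Real.exp (-ξ ^ 2 * ‖y‖ ^ 2) / (Real.sqrt π * ξ))) x
      = -(2 * ξ / √π * exp (-ξ ^ 2 * ‖x‖ ^ 2)) + 2 * (erfc (ξ * ‖x‖) / ‖x‖) := by
    simp only [lap, Fin.sum_univ_three, hpd, kron, if_true]
    linear_combination (-(2 * ξ / √π * exp (-ξ ^ 2 * ‖x‖ ^ 2)) - erfc (ξ * ‖x‖) / ‖x‖) * hsum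
  rw [hlap, hpd]
  ring
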